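/- arXiv:1404.0101 — 3 statements merged into one kernel-verified Lean document; each statement's English description precedes it below -/
import Mathlib

section
/- Let x₁, y₁, x₂, y₂ be nonnegative real numbers with (x₁ − x₂)·(y₁ − y₂) < 0 and (x₁ − y₁)·(x₂ − y₂) > 0. Then the supremum of min(u, v) over all (u, v) in the rate region R(x₁, y₁, x₂, y₂) equals max(min(x₁, y₁), min(x₂, y₂)). -/
/-- The rate region obtained by time sharing between two rate points
`(x₁, y₁)` and `(x₂, y₂)`. -/
def rateRegion (x₁ y₁ x₂ y₂ : ℝ) : Set (ℝ × ℝ) :=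
  {p | 0 ≤ p.1 ∧ 0 ≤ p.2 ∧
    ∃ t, 0 ≤ t ∧ t ≤ 1 ∧ p.1 ≤ t * x₁ + (1 - t) * x₂ ∧ p.2 ≤ t * y₁ + (1 - t) * y₂}

theorem left_mem_rateRegion {x₁ y₁ : ℝ} (x₂ y₂ : ℝ) (hx₁ : 0 ≤ x₁) (hy₁ : 0 ≤ y₁) :
    (x₁, y₁) ∈ rateRegion x₁ y₁ x₂ y₂ :=
  ⟨hx₁, hy₁, 1, by norm_num, le_rfl, by simp, by simp⟩

theorem right_mem_rateRegion (x₁ y₁ : ℝ) {x₂ y₂ : ℝ} (hx₂ : 0 ≤ x₂) (hy₂ : 0 ≤ y₂) :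
    (x₂, y₂) ∈ rateRegion x₁ y₁ x₂ y₂ :=
  ⟨hx₂, hy₂, 0, le_rfl, by norm_num, by simp, by simp⟩

theorem convex_comb_le_max {t : ℝ} (a b : ℝ) (ht₀ : 0 ≤ t) (ht₁ : t ≤ 1) :
    t * a + (1 - t) * b ≤ max a b := by
  have ha := mul_le_mul_of_nonneg_left (le_max_left a b) ht₀
  have hb := mul_le_mul_of_nonneg_left (le_max_right a b) (sub_nonneg.2 ht₁)
  linarith

theorem min_le_of_mem_rateRegion {x₁ y₁ x₂ y₂ : ℝ} (h : 0 < (x₁ - y₁) * (x₂ - y₂))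
    {p : ℝ × ℝ} (hp : p ∈ rateRegion x₁ y₁ x₂ y₂) :
    min p.1 p.2 ≤ max (min x₁ y₁) (min x₂ y₂) := by
  obtain ⟨-, -, t, ht₀, ht₁, hu, hv⟩ := hp
  rcases mul_pos_iff.1 h with ⟨h₁, h₂⟩ | ⟨h₁, h₂⟩
  · rw [min_eq_right (sub_pos.1 h₁).le, min_eq_right (sub_pos.1 h₂).le]
    exact (min_le_right _ _).trans (hv.trans (convex_comb_le_max _ _ ht₀ ht₁))
  · rw [min_eq_left (sub_neg.1 h₁).le, min_eq_left (sub_neg.1 h₂).le]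
    exact (min_le_left _ _).trans (hu.trans (convex_comb_le_max _ _ ht₀ ht₁))

theorem stmt_1 (x₁ y₁ x₂ y₂ : ℝ)
    (hx₁ : 0 ≤ x₁) (hy₁ : 0 ≤ y₁) (hx₂ : 0 ≤ x₂) (hy₂ : 0 ≤ y₂)
    (h1 : (x₁ - x₂) * (y₁ - y₂) < 0) (h2 : (x₁ - y₁) * (x₂ - y₂) > 0) :
    sSup {m : ℝ | ∃ p ∈ rateRegion x₁ y₁ x₂ y₂, m = min p.1 p.2}
      = max (min x₁ y₁) (min x₂ y₂) := by
  refine IsGreatest.csSup_eq ⟨?_, ?_⟩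
  · rcases max_choice (min x₁ y₁) (min x₂ y₂) with h | h
    · exact ⟨_, left_mem_rateRegion x₂ y₂ hx₁ hy₁, h⟩
    · exact ⟨_, right_mem_rateRegion x₁ y₁ hx₂ hy₂, h⟩
  · rintro m ⟨p, hp, rfl⟩
    exact min_le_of_mem_rateRegion h2 hp
end

section
/- Let n ≥ 1 and let (x₁, y₁), …, (x_n, y_n) be points in ℝ² with nonnegative coordinates. Let S be the downward closure (within the nonnegative quadrant) of the convex hull of these points. Then sup { min(u, v) : (u, v) ∈ S } = max over all pairs (i, j) with 1 ≤ i, j ≤ n of f(x_i, x_j, y_i, y_j). -/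
/-- The maximum minimum rate achievable by time sharing between the rate
points `(x₁, y₁)` and `(x₂, y₂)`. -/
noncomputable def maxMinRate (x₁ x₂ y₁ y₂ : ℝ) : ℝ :=
  if (x₁ - x₂) * (y₁ - y₂) ≥ 0 then min (max x₁ x₂) (max y₁ y₂)
  else if (x₁ - y₁) * (x₂ - y₂) ≥ 0 then max (min x₁ y₁) (min x₂ y₂)
  else (x₁ * y₂ - y₁ * x₂) / (y₂ - y₁ + x₁ - x₂)

/-- The pairwise rate is attained by some time sharing between the two points. -/
lemma exists_maxMinRate_le_min (x₁ x₂ y₁ y₂ : ℝ) :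
    ∃ t : ℝ, 0 ≤ t ∧ t ≤ 1 ∧ maxMinRate x₁ x₂ y₁ y₂ ≤
      min (t * x₁ + (1 - t) * x₂) (t * y₁ + (1 - t) * y₂) := by
  unfold maxMinRate
  split_ifs with h₁ h₂
  · rcases mul_nonneg_iff.mp h₁ with ⟨ha, hb⟩ | ⟨ha, hb⟩
    · exact ⟨1, by norm_num, le_rfl, min_le_min (by simpa using ha) (by simpa using hb)⟩
    · exact ⟨0, le_rfl, by norm_num, min_le_min (by simpa using ha) (by simpa using hb)⟩
  · rcases le_total (min x₁ y₁) (min x₂ y₂) with h | h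
    · exact ⟨0, le_rfl, by norm_num, by rw [max_eq_right h]; simp⟩
    · exact ⟨1, by norm_num, le_rfl, by rw [max_eq_left h]; simp⟩
  · rw [not_le, mul_neg_iff] at h₂
    have hD : y₂ - y₁ + x₁ - x₂ ≠ 0 := by
      rcases h₂ with ⟨ha, hb⟩ | ⟨ha, hb⟩
      · exact ne_of_gt (by linarith)
      · exact ne_of_lt (by linarith)
    refine ⟨(y₂ - x₂) / (y₂ - y₁ + x₁ - x₂), ?_, ?_, le_min (le_of_eq ?_) (le_of_eq ?_)⟩
    · rcases h₂ with ⟨ha, hb⟩ | ⟨ha, hb⟩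
      · exact div_nonneg (by linarith) (by linarith)
      · exact div_nonneg_of_nonpos (by linarith) (by linarith)
    · rcases h₂ with ⟨ha, hb⟩ | ⟨ha, hb⟩
      · exact (div_le_one (by linarith)).mpr (by linarith)
      · exact (div_le_one_of_neg (by linarith)).mpr (by linarith)
    all_goals
      field_simp
      ring

/-- Some convex weighting of the two coordinates certifies the upper bound for a pair. -/
lemma exists_weight_of_maxMinRate_le {x₁ x₂ y₁ y₂ M : ℝ} (h : maxMinRate x₁ x₂ y₁ y₂ ≤ M) :
    ∃ w : ℝ, 0 ≤ w ∧ w ≤ 1 ∧ w * x₁ + (1 - w) * y₁ ≤ M ∧ w * x₂ + (1 - w) * y₂ ≤ M := by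
  unfold maxMinRate at h
  split_ifs at h with h₁ h₂
  · rcases min_le_iff.mp h with h | h <;> obtain ⟨ha, hb⟩ := max_le_iff.mp h
    · exact ⟨1, by norm_num, le_rfl, by linarith, by linarith⟩
    · exact ⟨0, le_rfl, by norm_num, by linarith, by linarith⟩
  · rcases mul_nonneg_iff.mp h₂ with ⟨ha, hb⟩ | ⟨ha, hb⟩
    · rw [min_eq_right (by linarith), min_eq_right (by linarith), max_le_iff] at h
      exact ⟨0, le_rfl, by norm_num, by linarith, by linarith⟩
    · rw [min_eq_left (by linarith), min_eq_left (by linarith), max_le_iff] at h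
      exact ⟨1, by norm_num, le_rfl, by linarith, by linarith⟩
  · rw [not_le, mul_neg_iff] at h₁ h₂
    have hD : y₂ - y₁ + x₁ - x₂ ≠ 0 := by
      rcases h₂ with ⟨ha, hb⟩ | ⟨ha, hb⟩
      · exact ne_of_gt (by linarith)
      · exact ne_of_lt (by linarith)
    refine ⟨(y₂ - y₁) / (y₂ - y₁ + x₁ - x₂), ?_, ?_,
      le_trans (le_of_eq ?_) h, le_trans (le_of_eq ?_) h⟩
    · rcases h₁ with ⟨ha, hb⟩ | ⟨ha, hb⟩
      · exact div_nonneg (by linarith) (by linarith)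
      · exact div_nonneg_of_nonpos (by linarith) (by linarith)
    · rcases h₁ with ⟨ha, hb⟩ | ⟨ha, hb⟩
      · exact (div_le_one (by linarith)).mpr (by linarith)
      · exact (div_le_one_of_neg (by linarith)).mpr (by linarith)
    all_goals
      field_simp
      ring

/-- By Helly's theorem on the line, a single weighting certifies the bound for all points. -/
lemma exists_weight_of_forall_maxMinRate_le {ι : Type*} [Fintype ι] {x y : ι → ℝ} {M : ℝ}
    (h : ∀ i j, maxMinRate (x i) (x j) (y i) (y j) ≤ M) :
    ∃ w : ℝ, 0 ≤ w ∧ w ≤ 1 ∧ ∀ i, w * x i + (1 - w) * y i ≤ M := by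
  classical
  rcases isEmpty_or_nonempty ι with hι | ⟨⟨i₀⟩⟩
  · exact ⟨0, le_rfl, zero_le_one, fun i => hι.elim i⟩
  let F : ι → Set ℝ := fun i => {w | 0 ≤ w ∧ w ≤ 1 ∧ w * x i + (1 - w) * y i ≤ M}
  have hF : ∀ i ∈ (Finset.univ : Finset ι), Convex ℝ (F i) := by
    rintro i - u ⟨hu₀, hu₁, hu⟩ v ⟨hv₀, hv₁, hv⟩ a b ha hb hab
    simp only [F, Set.mem_ofPred_eq, smul_eq_mul]
    obtain rfl : b = 1 - a := by linarith
    refine ⟨by positivity, by nlinarith, ?_⟩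
    nlinarith [mul_le_mul_of_nonneg_left hu ha, mul_le_mul_of_nonneg_left hv hb]
  have hpair : ∀ I : Finset ι, I ⊆ Finset.univ → I.card ≤ Module.finrank ℝ ℝ + 1 →
      (⋂ i ∈ I, F i).Nonempty := by
    intro I _ hI
    rw [Module.finrank_self] at hI
    obtain ⟨i, j, hij⟩ : ∃ i j, I ⊆ {i, j} := by
      rcases Nat.lt_or_ge I.card 2 with hc | hc
      · have : Nonempty ι := ⟨i₀⟩
        rcases Finset.card_le_one_iff_subset_singleton.mp (Nat.lt_succ_iff.mp hc) with ⟨i, hi⟩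
        exact ⟨i, i, by simpa using hi⟩
      · obtain ⟨i, j, -, rfl⟩ := Finset.card_eq_two.mp (le_antisymm hI hc)
        exact ⟨i, j, subset_rfl⟩
    obtain ⟨w, hw₀, hw₁, hi, hj⟩ := exists_weight_of_maxMinRate_le (h i j)
    refine ⟨w, Set.mem_iInter₂.mpr fun k hk => ?_⟩
    have hk' := hij hk
    rw [Finset.mem_insert, Finset.mem_singleton] at hk'
    rcases hk' with rfl | rfl
    · exact ⟨hw₀, hw₁, hi⟩
    · exact ⟨hw₀, hw₁, hj⟩
  obtain ⟨w, hw⟩ := Convex.helly_theorem' (𝕜 := ℝ) hF hpair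
  have hw' : ∀ i, w ∈ F i := fun i => Set.mem_iInter₂.mp hw i (Finset.mem_univ i)
  exact ⟨w, (hw' i₀).1, (hw' i₀).2.1, fun i => (hw' i).2.2⟩

lemma min_le_of_mem_convexHull {ι : Type*} [Fintype ι] {x y : ι → ℝ} {M : ℝ}
    (h : ∀ i j, maxMinRate (x i) (x j) (y i) (y j) ≤ M) {q : ℝ × ℝ}
    (hq : q ∈ convexHull ℝ {q : ℝ × ℝ | ∃ i, q = (x i, y i)}) : min q.1 q.2 ≤ M := by
  obtain ⟨w, hw₀, hw₁, hw⟩ := exists_weight_of_forall_maxMinRate_le h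
  have hconv : Convex ℝ {p : ℝ × ℝ | w * p.1 + (1 - w) * p.2 ≤ M} := by
    intro p hp r hr a b ha hb hab
    simp only [Set.mem_ofPred_eq, Prod.fst_add, Prod.snd_add, Prod.smul_fst, Prod.smul_snd,
      smul_eq_mul] at hp hr ⊢
    obtain rfl : b = 1 - a := by linarith
    nlinarith [mul_le_mul_of_nonneg_left hp ha, mul_le_mul_of_nonneg_left hr hb]
  have hmem : w * q.1 + (1 - w) * q.2 ≤ M :=
    convexHull_min (by rintro _ ⟨i, rfl⟩; exact hw i) hconv hq
  nlinarith [mul_le_mul_of_nonneg_left (min_le_left q.1 q.2) hw₀,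
    mul_le_mul_of_nonneg_left (min_le_right q.1 q.2) (sub_nonneg.mpr hw₁)]

theorem stmt_5 (n : ℕ) (hn : 1 ≤ n) (x y : Fin n → ℝ)
    (hx : ∀ i, 0 ≤ x i) (hy : ∀ i, 0 ≤ y i) :
    sSup {m : ℝ | ∃ p : ℝ × ℝ, (0 ≤ p.1 ∧ 0 ≤ p.2 ∧
        ∃ q ∈ convexHull ℝ {q : ℝ × ℝ | ∃ i, q = (x i, y i)}, p.1 ≤ q.1 ∧ p.2 ≤ q.2) ∧
      m = min p.1 p.2}
    = Finset.univ.sup'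
        (Finset.univ_nonempty_iff.mpr ⟨(⟨0, hn⟩, ⟨0, hn⟩)⟩)
        (fun ij : Fin n × Fin n => maxMinRate (x ij.1) (x ij.2) (y ij.1) (y ij.2)) := by
  set M := Finset.univ.sup' (Finset.univ_nonempty_iff.mpr ⟨(⟨0, hn⟩, ⟨0, hn⟩)⟩)
    (fun ij : Fin n × Fin n => maxMinRate (x ij.1) (x ij.2) (y ij.1) (y ij.2)) with hM
  have hle : ∀ i j, maxMinRate (x i) (x j) (y i) (y j) ≤ M := fun i j =>
    Finset.le_sup' (fun ij : Fin n × Fin n => maxMinRate (x ij.1) (x ij.2) (y ij.1) (y ij.2))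
      (Finset.mem_univ (i, j))
  have hub : M ∈ upperBounds {m : ℝ | ∃ p : ℝ × ℝ, (0 ≤ p.1 ∧ 0 ≤ p.2 ∧
      ∃ q ∈ convexHull ℝ {q : ℝ × ℝ | ∃ i, q = (x i, y i)}, p.1 ≤ q.1 ∧ p.2 ≤ q.2) ∧
      m = min p.1 p.2} := by
    rintro _ ⟨p, ⟨-, -, q, hq, h₁, h₂⟩, rfl⟩
    exact (min_le_min h₁ h₂).trans (min_le_of_mem_convexHull hle hq)
  apply le_antisymm
  · have i₀ : Fin n := ⟨0, hn⟩
    exact csSup_le ⟨_, (x i₀, y i₀), ⟨hx i₀, hy i₀, _,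
      subset_convexHull ℝ _ ⟨i₀, rfl⟩, le_rfl, le_rfl⟩, rfl⟩ hub
  · refine Finset.sup'_le _ _ fun ij _ => ?_
    obtain ⟨i, j⟩ := ij
    obtain ⟨t, ht₀, ht₁, ht⟩ := exists_maxMinRate_le_min (x i) (x j) (y i) (y j)
    have ht₁' : 0 ≤ 1 - t := sub_nonneg.mpr ht₁
    have hq : t • (x i, y i) + (1 - t) • (x j, y j) ∈
        convexHull ℝ {q : ℝ × ℝ | ∃ i, q = (x i, y i)} :=
      (convex_convexHull ℝ _) (subset_convexHull ℝ _ (Set.mem_ofPred.mpr ⟨i, rfl⟩))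
        (subset_convexHull ℝ _ (Set.mem_ofPred.mpr ⟨j, rfl⟩)) ht₀ ht₁' (by ring)
    exact le_csSup_of_le ⟨M, hub⟩ ⟨_, ⟨add_nonneg (mul_nonneg ht₀ (hx i)) (mul_nonneg ht₁' (hx j)),
      add_nonneg (mul_nonneg ht₀ (hy i)) (mul_nonneg ht₁' (hy j)), _, hq, le_rfl, le_rfl⟩, rfl⟩ ht
end

section
/- Let γ_UF, γ_VF, γ_UB ≥ 0 and C_up > 0. Define β_EQ = (γ_UF + γ_VF + 1)/(2^{C_up} − 1) and β_WZ = (γ_VF + 1)/(2^{C_up} − 1) + γ_UF/((2^{C_up} − 1)·(γ_UB + 1)). Then β_WZ ≤ β_EQ, with strict inequality β_WZ < β_EQ if and only if γ_UF > 0 and γ_UB > 0. -/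
theorem stmt_8 (γUF γVF γUB Cup : ℝ)
    (hUF : 0 ≤ γUF) (hVF : 0 ≤ γVF) (hUB : 0 ≤ γUB) (hC : 0 < Cup) :
    (γVF + 1) / ((2 : ℝ) ^ Cup - 1) + γUF / (((2 : ℝ) ^ Cup - 1) * (γUB + 1))
      ≤ (γUF + γVF + 1) / ((2 : ℝ) ^ Cup - 1) ∧
    ((γVF + 1) / ((2 : ℝ) ^ Cup - 1) + γUF / (((2 : ℝ) ^ Cup - 1) * (γUB + 1))
      < (γUF + γVF + 1) / ((2 : ℝ) ^ Cup - 1) ↔ 0 < γUF ∧ 0 < γUB) := by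
  have hd : 0 < (2 : ℝ) ^ Cup - 1 := sub_pos.2 (Real.one_lt_rpow one_lt_two hC)
  generalize (2 : ℝ) ^ Cup - 1 = d at hd ⊢
  have hB : 0 < γUB + 1 := by positivity
  have gap : (γUF + γVF + 1) / d - ((γVF + 1) / d + γUF / (d * (γUB + 1)))
      = γUF * γUB / (d * (γUB + 1)) := by
    field_simp
    ring
  rw [← sub_nonneg, ← sub_pos, gap]
  refine ⟨by positivity, ?_⟩
  rw [div_pos_iff_of_pos_right (mul_pos hd hB)]
  constructor
  · intro h
    exact ⟨pos_of_mul_pos_left h hUB, pos_of_mul_pos_right h hUF⟩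
  · rintro ⟨h₁, h₂⟩
    exact mul_pos h₁ h₂
end
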